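/- Let L be a real symmetric m×m matrix with eigendecomposition L = Q·diag(λ₁,…,λ_m)·Qᵀ, where Q is an m×m orthogonal matrix. Then for every integer 1 ≤ ℓ ≤ m: Σ_{S ⊆ {1,…,m}, |S| = ℓ} I_Sᵀ · adj(L_{S,S}) · I_S = Q · diag(σ_{ℓ−1}(λ_{−1}), …, σ_{ℓ−1}(λ_{−m})) · Qᵀ, where λ = (λ₁,…,λ_m) and λ_{−i} denotes λ with its i-th entry removed. -/

import Mathlib

open Matrix

/-- The sampling matrix `I_S`, consisting of the rows of the `m × m` identity matrix
indexed by `S`. -/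
def sampleMatrix {m : ℕ} (S : Finset (Fin m)) : Matrix {x // x ∈ S} (Fin m) ℝ :=
  (1 : Matrix (Fin m) (Fin m) ℝ).submatrix (fun i => (i : Fin m)) id

/-- The adjugate `adj(M_{S,S})` of the principal submatrix of `M` indexed by `S`. -/
noncomputable def principalAdj {m : ℕ} (M : Matrix (Fin m) (Fin m) ℝ)
    (S : Finset (Fin m)) : Matrix {x // x ∈ S} {x // x ∈ S} ℝ :=
  (M.submatrix (fun i : {x // x ∈ S} => (i : Fin m)) (fun i : {x // x ∈ S} => (i : Fin m))).adjugate

/-- The matrix determinant lemma in adjugate form, for nonsingular matrices over a field. -/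
lemma det_add_vecMulVec_of_det_ne_zero {n K : Type*} [Fintype n] [DecidableEq n] [Field K]
    (A : Matrix n n K) (hA : A.det ≠ 0) (u v : n → K) :
    (A + vecMulVec u v).det = A.det + v ⬝ᵥ A.adjugate *ᵥ u := by
  have h := det_add_replicateCol_mul_replicateRow (ι := Unit) hA.isUnit u v
  rw [← vecMulVec_eq] at h
  rw [h, Matrix.mul_assoc, ← replicateCol_mulVec, det_unique (n := Unit), Matrix.add_apply, one_apply_eq,
    replicateRow_mul_replicateCol_apply, inv_def, Ring.inverse_eq_inv', smul_mulVec,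
    dotProduct_smul, smul_eq_mul, mul_add, mul_one, mul_inv_cancel_left₀ hA]

/-- The matrix determinant lemma in adjugate form, for nonsingular matrices over a domain. -/
lemma det_add_vecMulVec_of_isDomain {n R : Type*} [Fintype n] [DecidableEq n] [CommRing R]
    [IsDomain R] (A : Matrix n n R) (hA : A.det ≠ 0) (u v : n → R) :
    (A + vecMulVec u v).det = A.det + v ⬝ᵥ A.adjugate *ᵥ u := by
  let f := algebraMap R (FractionRing R)
  have hf : Function.Injective f := IsFractionRing.injective R (FractionRing R)
  apply hf
  have h := det_add_vecMulVec_of_det_ne_zero (f.mapMatrix A)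
    (by rw [← RingHom.map_det]; exact (map_ne_zero_iff f hf).mpr hA) (f ∘ u) (f ∘ v)
  have hmap : f.mapMatrix (A + vecMulVec u v) = f.mapMatrix A + vecMulVec (f ∘ u) (f ∘ v) := by
    ext i j
    simp [vecMulVec_apply]
  have hvec : f.mapMatrix A.adjugate *ᵥ (f ∘ u) = f ∘ (A.adjugate *ᵥ u) := by
    ext i
    exact (RingHom.map_mulVec f _ _ i).symm
  rw [RingHom.map_det, hmap, h, map_add, RingHom.map_det, RingHom.map_dotProduct,
    ← RingHom.map_adjugate, hvec]

/-- The matrix determinant lemma in adjugate form. -/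
lemma det_add_vecMulVec {n R : Type*} [Fintype n] [DecidableEq n] [CommRing R]
    [IsDomain R] (A : Matrix n n R) (u v : n → R) :
    (A + vecMulVec u v).det = A.det + v ⬝ᵥ A.adjugate *ᵥ u := by
  have h := congrArg (Polynomial.evalRingHom (0 : R)) <|
    det_add_vecMulVec_of_isDomain (charmatrix (-A)) (charpoly_monic (-A)).ne_zero
      (Polynomial.C ∘ u) (Polynomial.C ∘ v)
  have hA : (Polynomial.evalRingHom (0 : R)).mapMatrix (charmatrix (-A)) = A := by
    ext i j
    by_cases hij : i = j <;> simp [hij]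
  have hadd : (Polynomial.evalRingHom (0 : R)).mapMatrix
      (charmatrix (-A) + vecMulVec (Polynomial.C ∘ u) (Polynomial.C ∘ v))
      = A + vecMulVec u v := by
    rw [map_add, hA]
    ext i j
    simp [vecMulVec_apply]
  have hC (w : n → R) : Polynomial.evalRingHom (0 : R) ∘ (Polynomial.C ∘ w) = w := by
    ext i
    simp
  have hvec : Polynomial.evalRingHom (0 : R) ∘ ((charmatrix (-A)).adjugate *ᵥ (Polynomial.C ∘ u))
      = A.adjugate *ᵥ u := by
    ext i
    rw [Function.comp_apply, RingHom.map_mulVec, hC, ← RingHom.mapMatrix_apply,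
      RingHom.map_adjugate, hA]
  rwa [RingHom.map_det, hadd, map_add, RingHom.map_det, hA, RingHom.map_dotProduct, hC,
    hvec] at h

lemma sampleMatrix_mulVec {m : ℕ} (S : Finset (Fin m)) (u : Fin m → ℝ) :
    sampleMatrix S *ᵥ u = fun i : S => u i := by
  ext i
  simp [sampleMatrix, mulVec, dotProduct, one_apply]

/-- The sum of the principal minors of size `ℓ`. -/
noncomputable def sumPrincipalMinors {m : ℕ} (ℓ : ℕ) (M : Matrix (Fin m) (Fin m) ℝ) : ℝ :=
  ∑ S ∈ Finset.powersetCard ℓ (Finset.univ : Finset (Fin m)),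
    (M.submatrix (Subtype.val : S → Fin m) (Subtype.val : S → Fin m)).det

/-- The sum of the adjugates of the principal submatrices of size `ℓ`. -/
noncomputable def sumPrincipalAdj {m : ℕ} (ℓ : ℕ) (M : Matrix (Fin m) (Fin m) ℝ) :
    Matrix (Fin m) (Fin m) ℝ :=
  ∑ S ∈ Finset.powersetCard ℓ (Finset.univ : Finset (Fin m)),
    (sampleMatrix S)ᵀ * principalAdj M S * sampleMatrix S

lemma sumPrincipalMinors_add_vecMulVec {m : ℕ} (ℓ : ℕ) (M : Matrix (Fin m) (Fin m) ℝ)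
    (u v : Fin m → ℝ) :
    sumPrincipalMinors ℓ (M + vecMulVec u v)
      = sumPrincipalMinors ℓ M + v ⬝ᵥ sumPrincipalAdj ℓ M *ᵥ u := by
  simp only [sumPrincipalMinors, sumPrincipalAdj, sum_mulVec, dotProduct_sum,
    ← Finset.sum_add_distrib]
  refine Finset.sum_congr rfl fun S _ => ?_
  have h : (M + vecMulVec u v).submatrix (Subtype.val : S → Fin m) (Subtype.val : S → Fin m)
      = M.submatrix Subtype.val Subtype.val
        + vecMulVec (fun i : S => u i) (fun i : S => v i) := rfl
  rw [h, det_add_vecMulVec, ← mulVec_mulVec, ← mulVec_mulVec, dotProduct_mulVec v,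
    vecMul_transpose, sampleMatrix_mulVec, sampleMatrix_mulVec]
  rfl

lemma sumPrincipalMinors_conj {m : ℕ} {ℓ : ℕ} (hm : ℓ ≤ m) (M Q : Matrix (Fin m) (Fin m) ℝ)
    (hQ : Qᵀ * Q = 1) :
    sumPrincipalMinors ℓ (Q * M * Qᵀ) = sumPrincipalMinors ℓ M := by
  have hchar : (Q * M * Qᵀ).charpoly = M.charpoly := by
    rw [charpoly_mul_comm, ← Matrix.mul_assoc, hQ, Matrix.one_mul]
  have hℓ : ℓ ≤ Fintype.card (Fin m) := by simpa using hm
  have h := charpoly_coeff_eq_sum_minors (Q * M * Qᵀ) ℓ hℓ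
  rw [hchar, charpoly_coeff_eq_sum_minors M ℓ hℓ] at h
  exact (mul_left_cancel₀ (pow_ne_zero ℓ (neg_ne_zero.mpr one_ne_zero)) h).symm

lemma sumPrincipalAdj_conj {m : ℕ} {ℓ : ℕ} (hm : ℓ ≤ m) (M Q : Matrix (Fin m) (Fin m) ℝ)
    (hQ : Qᵀ * Q = 1) :
    sumPrincipalAdj ℓ (Q * M * Qᵀ) = Q * sumPrincipalAdj ℓ M * Qᵀ := by
  have hQ' : Q * Qᵀ = 1 := mul_eq_one_comm.mp hQ
  have key (u v : Fin m → ℝ) : v ⬝ᵥ sumPrincipalAdj ℓ (Q * M * Qᵀ) *ᵥ u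
      = v ⬝ᵥ (Q * sumPrincipalAdj ℓ M * Qᵀ) *ᵥ u := by
    have hrank : Q * M * Qᵀ + vecMulVec u v
        = Q * (M + vecMulVec (Qᵀ *ᵥ u) (Qᵀ *ᵥ v)) * Qᵀ := by
      rw [Matrix.mul_add, Matrix.add_mul, mul_vecMulVec, vecMulVec_mul, mulVec_mulVec, hQ',
        one_mulVec, vecMul_transpose, mulVec_mulVec, hQ', one_mulVec]
    have h := sumPrincipalMinors_add_vecMulVec ℓ (Q * M * Qᵀ) u v
    rw [hrank, sumPrincipalMinors_conj hm _ Q hQ, sumPrincipalMinors_conj hm _ Q hQ,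
      sumPrincipalMinors_add_vecMulVec] at h
    rw [← add_left_cancel h, ← mulVec_mulVec, ← mulVec_mulVec, dotProduct_mulVec v Q,
      mulVec_transpose Q v]
  ext i j
  simpa using key (Pi.single j 1) (Pi.single i 1)

lemma sampleMatrix_conj_diagonal {m : ℕ} (lam : Fin m → ℝ) (S : Finset (Fin m)) :
    (sampleMatrix S)ᵀ * principalAdj (diagonal lam) S * sampleMatrix S
      = diagonal fun i => if i ∈ S then ∏ j ∈ S.erase i, lam j else 0 := by
  have hadj : principalAdj (diagonal lam) S
      = diagonal fun i : S => ∏ j ∈ S.erase i, lam j := by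
    rw [principalAdj, submatrix_diagonal _ _ Subtype.val_injective, adjugate_diagonal]
    congr 1
    ext i
    refine Finset.prod_bij (fun j _ => (j : Fin m)) ?_ ?_ ?_ ?_
    · intro j hj
      rw [Finset.mem_erase] at hj ⊢
      exact ⟨fun h => hj.1 (Subtype.ext h), j.2⟩
    · intro j _ k _ h
      exact Subtype.ext h
    · intro j hj
      rw [Finset.mem_erase] at hj
      exact ⟨⟨j, hj.2⟩, Finset.mem_erase.mpr
        ⟨fun h => hj.1 (congrArg Subtype.val h), Finset.mem_univ _⟩, rfl⟩
    · intro j _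
      rfl
  rw [hadj]
  ext i j
  rw [Matrix.mul_apply]
  simp only [mul_diagonal, transpose_apply, sampleMatrix, submatrix_apply, id, one_apply,
    diagonal_apply]
  rw [Finset.sum_coe_sort S (fun x => (if x = i then (1 : ℝ) else 0) * (∏ j ∈ S.erase x, lam j)
    * if x = j then 1 else 0)]
  by_cases hij : i = j <;> simp [hij]
  intro _ h
  exact absurd h.symm hij

lemma sumPrincipalAdj_diagonal {m : ℕ} {ℓ : ℕ} (h1 : 1 ≤ ℓ) (lam : Fin m → ℝ) :
    sumPrincipalAdj ℓ (diagonal lam) = diagonal fun i =>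
      ∑ T ∈ Finset.powersetCard (ℓ - 1) (Finset.univ.erase i), ∏ j ∈ T, lam j := by
  simp only [sumPrincipalAdj, sampleMatrix_conj_diagonal]
  ext i j
  rw [Matrix.sum_apply]
  obtain rfl | hij := eq_or_ne i j
  · simp only [diagonal_apply_eq]
    rw [← Finset.sum_filter]
    refine Finset.sum_nbij' (fun S => S.erase i) (fun T => insert i T) ?_ ?_ ?_ ?_ ?_
    · intro S hS
      simp only [Finset.mem_filter, Finset.mem_powersetCard_univ] at hS
      rw [Finset.mem_powersetCard]
      exact ⟨Finset.erase_subset_erase i (Finset.subset_univ S),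
        by rw [Finset.card_erase_of_mem hS.2, hS.1]⟩
    · intro T hT
      rw [Finset.mem_powersetCard, Finset.subset_erase] at hT
      simp only [Finset.mem_filter, Finset.mem_powersetCard_univ]
      exact ⟨by rw [Finset.card_insert_of_notMem hT.1.2]; lia, Finset.mem_insert_self i T⟩
    · intro S hS
      exact Finset.insert_erase (Finset.mem_filter.mp hS).2
    · intro T hT
      rw [Finset.mem_powersetCard, Finset.subset_erase] at hT
      exact Finset.erase_insert hT.1.2
    · intro S _
      rfl
  · simp [diagonal_apply_ne _ hij]

/-- Lemma 3.3 of [RK20]: let `L = Q·diag(λ₁,…,λ_m)·Qᵀ` with `Q`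
orthogonal. Then for every `1 ≤ ℓ ≤ m`:
`Σ_{|S| = ℓ} I_Sᵀ · adj(L_{S,S}) · I_S = Q · diag(σ_{ℓ−1}(λ_{−1}), …, σ_{ℓ−1}(λ_{−m})) · Qᵀ`,
where `σ_{ℓ−1}(λ_{−i}) = Σ_{T ⊆ [m]∖{i}, |T| = ℓ−1} Π_{j ∈ T} λ_j` is the elementary
symmetric polynomial of degree `ℓ−1` of `λ` with its `i`-th entry removed. -/
theorem stmt1 {m : ℕ} (L : Matrix (Fin m) (Fin m) ℝ) (lam : Fin m → ℝ)
    (Q : Matrix (Fin m) (Fin m) ℝ) (hQ : Qᵀ * Q = 1)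
    (hL : L = Q * Matrix.diagonal lam * Qᵀ)
    (ℓ : ℕ) (h1 : 1 ≤ ℓ) (hm : ℓ ≤ m) :
    ∑ S ∈ Finset.powersetCard ℓ (Finset.univ : Finset (Fin m)),
        (sampleMatrix S)ᵀ * principalAdj L S * sampleMatrix S
      = Q * Matrix.diagonal (fun i : Fin m =>
          ∑ T ∈ Finset.powersetCard (ℓ - 1) (Finset.univ.erase i), ∏ j ∈ T, lam j) * Qᵀ := by
  subst hL
  rw [← sumPrincipalAdj_diagonal h1]
  exact sumPrincipalAdj_conj hm _ Q hQ
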